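/- arXiv:2202.08575 — 2 statements merged into one kernel-verified Lean document; each statement's English description precedes it below -/
import Mathlib

section
/- Let T₁, T₂ : M → A be O-operators on an associative conformal algebra A with respect to a conformal bimodule M, and suppose T₁ and T₂ are compatible, i.e., T₁ + T₂ is again an O-operator. Then the dendriform conformal algebra structures on M given by m ≻^{T₁}_λ n = T₁(m)_λ n, m ≺^{T₁}_λ n = m_λ T₁(n) and m ≻^{T₂}_λ n = T₂(m)_λ n, m ≺^{T₂}_λ n = m_λ T₂(n) are compatible, i.e., M equipped with the λ-products ≻^{T₁}_λ + ≻^{T₂}_λ and ≺^{T₁}_λ + ≺^{T₂}_λ is again a dendriform conformal algebra. -/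
open Polynomial

noncomputable section

/-!  Framework for associative conformal algebras over `ℂ[∂]`.

A `ℂ[∂]`-module is modelled as a module over `ℂ[X]` (with the variable `X`
playing the role of `∂`), together with a compatible `ℂ`-action.  A polynomial
`Σᵢ λ^i cᵢ` in a formal variable `λ` with coefficients in a module `V` is
recorded by its finitely supported family of coefficients `ℕ →₀ V`.  Identities
between such polynomials are stated through their evaluations at every
`lam : ℂ`; over the infinite field `ℂ` this is equivalent to the corresponding
polynomial identities. -/

/-- Evaluation at `lam : ℂ` of a `V`-valued polynomial given by its coefficients. -/
def cev {V : Type*} [AddCommMonoid V] [Module ℂ V] (lam : ℂ) (p : ℕ →₀ V) : V :=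
  p.sum fun i c => lam ^ i • c

/-- Substitution `μ ↦ -λ - ∂` in the polynomial `μ ↦ Σᵢ μ^i cᵢ`, where `∂ = X`
acts through the `ℂ[∂]`-module structure. -/
def csub {V : Type*} [AddCommMonoid V] [Module ℂ[X] V] (lam : ℂ) (p : ℕ →₀ V) : V :=
  p.sum fun i c => ((-(C lam) - X) ^ i : ℂ[X]) • c

/-- A `ℂ`-bilinear conformal sesquilinear λ-product `A × B → M[λ]`, recorded by
the coefficient family `coeff a b : ℕ →₀ M` of the polynomial `a_λ b`. -/
structure ConfBilin (A B M : Type*)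
    [AddCommGroup A] [Module ℂ A] [Module ℂ[X] A]
    [AddCommGroup B] [Module ℂ B] [Module ℂ[X] B]
    [AddCommGroup M] [Module ℂ M] [Module ℂ[X] M] where
  coeff : A → B → ℕ →₀ M
  add_left : ∀ a a' b, coeff (a + a') b = coeff a b + coeff a' b
  smul_left : ∀ (c : ℂ) a b, coeff (c • a) b = c • coeff a b
  add_right : ∀ a b b', coeff a (b + b') = coeff a b + coeff a b'
  smul_right : ∀ (c : ℂ) a b, coeff a (c • b) = c • coeff a b
  /-- `(∂a)_λ b = -λ (a_λ b)` -/
  sesq_left : ∀ (lam : ℂ) (a : A) (b : B),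
    cev lam (coeff ((X : ℂ[X]) • a) b) = (-lam) • cev lam (coeff a b)
  /-- `a_λ (∂b) = (∂ + λ) (a_λ b)` -/
  sesq_right : ∀ (lam : ℂ) (a : A) (b : B),
    cev lam (coeff a ((X : ℂ[X]) • b)) =
      (X : ℂ[X]) • cev lam (coeff a b) + lam • cev lam (coeff a b)

namespace ConfBilin

variable {A B M : Type*}
  [AddCommGroup A] [Module ℂ A] [Module ℂ[X] A]
  [AddCommGroup B] [Module ℂ B] [Module ℂ[X] B]
  [AddCommGroup M] [Module ℂ M] [Module ℂ[X] M]

/-- `a_lam b` : the λ-product evaluated at `lam : ℂ`. -/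
def mul (f : ConfBilin A B M) (lam : ℂ) (a : A) (b : B) : M := cev lam (f.coeff a b)

/-- `a_{-λ-∂} b` : the λ-product with `-λ-∂` substituted for the variable. -/
def mulNeg (f : ConfBilin A B M) (lam : ℂ) (a : A) (b : B) : M := csub lam (f.coeff a b)

end ConfBilin

/-- An associative conformal algebra structure on the `ℂ[∂]`-module `A`. -/
structure AssocConfAlg (A : Type*)
    [AddCommGroup A] [Module ℂ A] [Module ℂ[X] A] extends ConfBilin A A A where
  /-- `(a_λ b)_{λ+μ} c = a_λ (b_μ c)` -/
  assoc : ∀ (lam mu : ℂ) (a b c : A),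
    toConfBilin.mul (lam + mu) (toConfBilin.mul lam a b) c =
      toConfBilin.mul lam a (toConfBilin.mul mu b c)

namespace AssocConfAlg

variable {A : Type*} [AddCommGroup A] [Module ℂ A] [Module ℂ[X] A]

def mul (θ : AssocConfAlg A) : ℂ → A → A → A := θ.toConfBilin.mul

def mulNeg (θ : AssocConfAlg A) : ℂ → A → A → A := θ.toConfBilin.mulNeg

end AssocConfAlg

/-- A conformal bimodule `M` over the associative conformal algebra `(A, θ)`,
with left action `l` and right action `r`. -/
structure ConfBimod {A : Type*} [AddCommGroup A] [Module ℂ A] [Module ℂ[X] A]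
    (θ : AssocConfAlg A) (M : Type*)
    [AddCommGroup M] [Module ℂ M] [Module ℂ[X] M] where
  l : ConfBilin A M M
  r : ConfBilin M A M
  /-- `(a_λ b)_{λ+μ} m = a_λ (b_μ m)` -/
  assoc_ll : ∀ (lam mu : ℂ) (a b : A) (m : M),
    l.mul (lam + mu) (θ.mul lam a b) m = l.mul lam a (l.mul mu b m)
  /-- `(m_λ a)_{λ+μ} b = m_λ (a_μ b)` -/
  assoc_rr : ∀ (lam mu : ℂ) (m : M) (a b : A),
    r.mul (lam + mu) (r.mul lam m a) b = r.mul lam m (θ.mul mu a b)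
  /-- `(a_λ m)_{λ+μ} b = a_λ (m_μ b)` -/
  assoc_lr : ∀ (lam mu : ℂ) (a : A) (m : M) (b : A),
    r.mul (lam + mu) (l.mul lam a m) b = l.mul lam a (r.mul mu m b)

section Defs

variable {A M : Type*}
  [AddCommGroup A] [Module ℂ A] [Module ℂ[X] A]
  [AddCommGroup M] [Module ℂ M] [Module ℂ[X] M]

/-- `T : M → A` is an `𝒪`-operator on `(A, θ)` with respect to the conformal
bimodule `ρ` : `T(m)_λ T(n) = T (T(m)_λ n + m_λ T(n))`. -/
def IsOOperator {θ : AssocConfAlg A} (ρ : ConfBimod θ M) (T : M → A) : Prop :=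
  ∀ (lam : ℂ) (m n : M),
    θ.mul lam (T m) (T n) = T (ρ.l.mul lam (T m) n + ρ.r.mul lam m (T n))

/-- `N : A → A` is a Nijenhuis operator :
`N(a)_λ N(b) = N (N(a)_λ b + a_λ N(b) - N(a_λ b))`. -/
def IsNijenhuis (θ : AssocConfAlg A) (N : A → A) : Prop :=
  ∀ (lam : ℂ) (a b : A),
    θ.mul lam (N a) (N b) =
      N (θ.mul lam (N a) b + θ.mul lam a (N b) - N (θ.mul lam a b))

/-- `T : A → A` is a Rota-Baxter operator of weight `q`. -/
def IsRotaBaxterWt (θ : AssocConfAlg A) (q : ℂ) (T : A → A) : Prop :=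
  ∀ (lam : ℂ) (a b : A),
    θ.mul lam (T a) (T b) =
      T (θ.mul lam (T a) b + θ.mul lam a (T b) + q • θ.mul lam a b)

/-- The Hochschild 2-cocycle identity for an `M`-valued λ-bilinear map `ψ` on `A`. -/
def IsTwoCocycleFun {θ : AssocConfAlg A} (ρ : ConfBimod θ M)
    (ψ : ℂ → A → A → M) : Prop :=
  ∀ (lam mu : ℂ) (a b c : A),
    ρ.l.mul lam a (ψ mu b c) - ψ (lam + mu) (θ.mul lam a b) c
      + ψ lam a (θ.mul mu b c) - ρ.r.mul (lam + mu) (ψ lam a b) c = 0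

/-- `φ` is a 2-cocycle in `C²(A, M)`. -/
def IsTwoCocycle {θ : AssocConfAlg A} (ρ : ConfBimod θ M)
    (φ : ConfBilin A A M) : Prop :=
  IsTwoCocycleFun ρ φ.mul

/-- `T : M → A` is a `φ`-twisted Rota-Baxter operator :
`T(m)_λ T(n) = T (T(m)_λ n + m_λ T(n) + φ_λ(T(m), T(n)))`. -/
def IsTwistedRB {θ : AssocConfAlg A} (ρ : ConfBimod θ M) (φ : ConfBilin A A M)
    (T : M → A) : Prop :=
  ∀ (lam : ℂ) (m n : M),
    θ.mul lam (T m) (T n) =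
      T (ρ.l.mul lam (T m) n + ρ.r.mul lam m (T n) + φ.mul lam (T m) (T n))

/-- The λ-product of the semidirect product `A ⊕₀ M`. -/
def sdMul {θ : AssocConfAlg A} (ρ : ConfBimod θ M) (lam : ℂ) (x y : A × M) : A × M :=
  (θ.mul lam x.1 y.1, ρ.l.mul lam x.1 y.2 + ρ.r.mul lam x.2 y.1)

/-- The λ-product of the twisted semidirect product `A ⊕_ψ M`. -/
def sdMulTw {θ : AssocConfAlg A} (ρ : ConfBimod θ M) (ψ : ℂ → A → A → M)
    (lam : ℂ) (x y : A × M) : A × M :=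
  (θ.mul lam x.1 y.1, ρ.l.mul lam x.1 y.2 + ρ.r.mul lam x.2 y.1 + ψ lam x.1 y.1)

/-- The lift `T̂(a, m) = (T(m), 0)` of a map `T : M → A` to `A ⊕ M`. -/
def liftMap (T : M → A) (x : A × M) : A × M := (T x.2, 0)

/-- The λ-product `m ⋆_λ n = T(m)_λ n + m_λ T(n)` on `M` induced by an `𝒪`-operator. -/
def oStar {θ : AssocConfAlg A} (ρ : ConfBimod θ M) (T : M → A)
    (lam : ℂ) (m n : M) : M :=
  ρ.l.mul lam (T m) n + ρ.r.mul lam m (T n)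

/-- The left λ-action `m ·_λ a = T(m)_λ a - T(m_λ a)` of `M_ass` on `A`. -/
def oDotL {θ : AssocConfAlg A} (ρ : ConfBimod θ M) (T : M → A)
    (lam : ℂ) (m : M) (a : A) : A :=
  θ.mul lam (T m) a - T (ρ.r.mul lam m a)

/-- The right λ-action `a ·_λ m = a_λ T(m) - T(a_λ m)` of `M_ass` on `A`. -/
def oDotR {θ : AssocConfAlg A} (ρ : ConfBimod θ M) (T : M → A)
    (lam : ℂ) (a : A) (m : M) : A :=
  θ.mul lam a (T m) - T (ρ.l.mul lam a m)

/-- `m ⋆^φ_λ n = T(m)_λ n + m_λ T(n) + φ_λ(T(m), T(n))`. -/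
def twStar {θ : AssocConfAlg A} (ρ : ConfBimod θ M) (φ : ConfBilin A A M)
    (T : M → A) (lam : ℂ) (m n : M) : M :=
  ρ.l.mul lam (T m) n + ρ.r.mul lam m (T n) + φ.mul lam (T m) (T n)

/-- `m ·^φ_λ a = T(m)_λ a - T (m_λ a + φ_λ(T(m), a))`. -/
def twDotL {θ : AssocConfAlg A} (ρ : ConfBimod θ M) (φ : ConfBilin A A M)
    (T : M → A) (lam : ℂ) (m : M) (a : A) : A :=
  θ.mul lam (T m) a - T (ρ.r.mul lam m a + φ.mul lam (T m) a)

/-- `a ·^φ_λ m = a_λ T(m) - T (a_λ m + φ_λ(a, T(m)))`. -/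
def twDotR {θ : AssocConfAlg A} (ρ : ConfBimod θ M) (φ : ConfBilin A A M)
    (T : M → A) (lam : ℂ) (a : A) (m : M) : A :=
  θ.mul lam a (T m) - T (ρ.l.mul lam a m + φ.mul lam a (T m))

/-- The map `(a, m) ↦ (a, m - h(a))` on `A ⊕ M`. -/
def shiftMap (h : A → M) (p : A × M) : A × M := (p.1, p.2 - h p.1)

/-- The deformed λ-product `a ∘^N_λ b = N(a)_λ b + a_λ N(b) - N(a_λ b)`. -/
def nijProd (θ : AssocConfAlg A) (N : A → A) (lam : ℂ) (a b : A) : A :=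
  θ.mul lam (N a) b + θ.mul lam a (N b) - N (θ.mul lam a b)

end Defs

/-- A dendriform conformal algebra. -/
structure DendriformConfAlg (E : Type*)
    [AddCommGroup E] [Module ℂ E] [Module ℂ[X] E] where
  succ : ConfBilin E E E
  prec : ConfBilin E E E
  dend1 : ∀ (lam mu : ℂ) (a b c : E),
    succ.mul lam a (succ.mul mu b c) =
      succ.mul (lam + mu) (succ.mul lam a b + prec.mul lam a b) c
  dend2 : ∀ (lam mu : ℂ) (a b c : E),
    prec.mul (lam + mu) (prec.mul lam a b) c =
      prec.mul lam a (succ.mul mu b c + prec.mul mu b c)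
  dend3 : ∀ (lam mu : ℂ) (a b c : E),
    prec.mul (lam + mu) (succ.mul lam a b) c = succ.mul lam a (prec.mul mu b c)

/-- The product `a ∘_λ b = a ≻_λ b - b ≺_{-λ-∂} a` of a dendriform conformal algebra. -/
def dendComp {E : Type*} [AddCommGroup E] [Module ℂ E] [Module ℂ[X] E]
    (D : DendriformConfAlg E) (lam : ℂ) (a b : E) : E :=
  D.succ.mul lam a b - D.prec.mulNeg lam b a

/-- A conformal NS-algebra. -/
structure NSConfAlg (E : Type*)
    [AddCommGroup E] [Module ℂ E] [Module ℂ[X] E] where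
  succ : ConfBilin E E E
  prec : ConfBilin E E E
  vee : ConfBilin E E E
  ns1 : ∀ (lam mu : ℂ) (x y z : E),
    succ.mul lam x (succ.mul mu y z) =
      succ.mul (lam + mu) (succ.mul lam x y + prec.mul lam x y + vee.mul lam x y) z
  ns2 : ∀ (lam mu : ℂ) (x y z : E),
    prec.mul lam x (succ.mul mu y z + prec.mul mu y z + vee.mul mu y z) =
      prec.mul (lam + mu) (prec.mul lam x y) z
  ns3 : ∀ (lam mu : ℂ) (x y z : E),
    succ.mul lam x (prec.mul mu y z) = prec.mul (lam + mu) (succ.mul lam x y) z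
  ns4 : ∀ (lam mu : ℂ) (x y z : E),
    succ.mul lam x (vee.mul mu y z)
        - vee.mul (lam + mu) (succ.mul lam x y + prec.mul lam x y + vee.mul lam x y) z =
      prec.mul (lam + mu) (vee.mul lam x y) z
        - vee.mul lam x (succ.mul mu y z + prec.mul mu y z + vee.mul mu y z)

/-- `x ×_λ y = x ≻_λ y + x ≺_λ y + x ∨_λ y` in a conformal NS-algebra. -/
def nsTimes {E : Type*} [AddCommGroup E] [Module ℂ E] [Module ℂ[X] E]
    (NS : NSConfAlg E) (lam : ℂ) (x y : E) : E :=
  NS.succ.mul lam x y + NS.prec.mul lam x y + NS.vee.mul lam x y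

theorem cev_add' {V : Type*} [AddCommMonoid V] [Module ℂ V] (lam : ℂ) (p q : ℕ →₀ V) :
    cev lam (p + q) = cev lam p + cev lam q := by
  unfold cev
  exact Finsupp.sum_add_index' (fun i => smul_zero _) (fun i a b => smul_add _ a b)

/-- compatible `𝒪`-operators induce compatible dendriform conformal
algebra structures: the sums of the induced dendriform products again form a
dendriform conformal algebra on `M`. -/
theorem stmt6 {A M : Type*}
    [AddCommGroup A] [Module ℂ A] [Module ℂ[X] A] [IsScalarTower ℂ ℂ[X] A]
    [AddCommGroup M] [Module ℂ M] [Module ℂ[X] M] [IsScalarTower ℂ ℂ[X] M]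
    (θ : AssocConfAlg A) (ρ : ConfBimod θ M) (T₁ T₂ : M →ₗ[ℂ[X]] A)
    (h1 : IsOOperator ρ ⇑T₁) (h2 : IsOOperator ρ ⇑T₂)
    (hcomp : IsOOperator ρ (fun m => T₁ m + T₂ m)) :
    ∃ D : DendriformConfAlg M,
      (∀ (lam : ℂ) (m n : M),
        D.succ.mul lam m n = ρ.l.mul lam (T₁ m) n + ρ.l.mul lam (T₂ m) n) ∧
      (∀ (lam : ℂ) (m n : M),
        D.prec.mul lam m n = ρ.r.mul lam m (T₁ n) + ρ.r.mul lam m (T₂ n)) := by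
  obtain ⟨T, hT⟩ : ∃ T : M →ₗ[ℂ[X]] A, ∀ m, T m = T₁ m + T₂ m :=
    ⟨T₁ + T₂, fun m => rfl⟩
  have h : ∀ (lam : ℂ) (m n : M),
      θ.mul lam (T m) (T n) = T (ρ.l.mul lam (T m) n + ρ.r.mul lam m (T n)) := by
    intro lam m n
    simp only [hT]
    exact hcomp lam m n
  have hs : ∀ (c : ℂ) (m : M), T (c • m) = c • T m := fun c m =>
    LinearMap.map_smul_of_tower T c m
  refine ⟨{
    succ :=
      { coeff := fun m n => ρ.l.coeff (T m) n
        add_left := fun a a' b => by rw [map_add, ρ.l.add_left]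
        smul_left := fun c a b => by rw [hs, ρ.l.smul_left]
        add_right := fun a b b' => ρ.l.add_right _ _ _
        smul_right := fun c a b => ρ.l.smul_right _ _ _
        sesq_left := fun lam a b => by rw [map_smul, ρ.l.sesq_left]
        sesq_right := fun lam a b => ρ.l.sesq_right _ _ _ }
    prec :=
      { coeff := fun m n => ρ.r.coeff m (T n)
        add_left := fun a a' b => ρ.r.add_left _ _ _
        smul_left := fun c a b => ρ.r.smul_left _ _ _
        add_right := fun a b b' => by rw [map_add, ρ.r.add_right]
        smul_right := fun c a b => by rw [hs, ρ.r.smul_right]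
        sesq_left := fun lam a b => ρ.r.sesq_left _ _ _
        sesq_right := fun lam a b => by rw [map_smul, ρ.r.sesq_right] }
    dend1 := fun lam mu a b c => ?_
    dend2 := fun lam mu a b c => ?_
    dend3 := fun lam mu a b c => ρ.assoc_lr lam mu (T a) b (T c) }, ?_, ?_⟩
  · change ρ.l.mul lam (T a) (ρ.l.mul mu (T b) c) =
      ρ.l.mul (lam + mu) (T (ρ.l.mul lam (T a) b + ρ.r.mul lam a (T b))) c
    rw [← h, ρ.assoc_ll]
  · change ρ.r.mul (lam + mu) (ρ.r.mul lam a (T b)) (T c) =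
      ρ.r.mul lam a (T (ρ.l.mul mu (T b) c + ρ.r.mul mu b (T c)))
    rw [← h, ρ.assoc_rr]
  · intro lam m n
    change cev lam (ρ.l.coeff (T m) n) = _
    rw [hT, ρ.l.add_left, cev_add']
    rfl
  · intro lam m n
    change cev lam (ρ.r.coeff m (T n)) = _
    rw [hT, ρ.r.add_right, cev_add']
    rfl
end
end

section
/- Let A be an associative conformal algebra, M a conformal bimodule over A, and φ a commutative 2-cocycle in C²(A,M), i.e., a 2-cocycle with φ_λ(a,b) = φ_{−λ−∂}(b,a) for all a, b ∈ A. If T : M → A is a φ-Rota-Baxter operator, then T is an O-operator on the commutator Lie conformal algebra A^L associated with the representation ρ on M: for all m, n ∈ M, T(m)_λ T(n) − T(n)_{−λ−∂} T(m) = T(ρ(T(m))_λ n − ρ(T(n))_{−λ−∂} m). -/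
open Polynomial

noncomputable section

theorem aux_cev_inj {V : Type*} [AddCommGroup V] [Module ℂ V] (p : ℕ →₀ V)
    (h : ∀ lam : ℂ, cev lam p = 0) : p = 0 := by
  ext i
  rw [Finsupp.zero_apply, ← Module.forall_dual_apply_eq_zero_iff ℂ]
  intro f
  have hP : (∑ j ∈ p.support, Polynomial.monomial j (f (p j)) : ℂ[X]) = 0 := by
    apply Polynomial.funext
    intro x
    have := congrArg f (h x)
    simp only [cev, Finsupp.sum, map_sum, map_smul, map_zero, smul_eq_mul] at this
    rw [Polynomial.eval_finset_sum, Polynomial.eval_zero, ← this]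
    refine Finset.sum_congr rfl fun j _ => ?_
    rw [Polynomial.eval_monomial, mul_comm]
  have h2 := congrArg (fun P : ℂ[X] => P.coeff i) hP
  simp only [Polynomial.finset_sum_coeff, Polynomial.coeff_monomial, Polynomial.coeff_zero,
    Finset.sum_ite_eq', Finsupp.mem_support_iff] at h2
  by_cases hi : p i = 0
  · rw [hi, map_zero]
  · simpa [hi] using h2

theorem aux_cev_add {V : Type*} [AddCommGroup V] [Module ℂ V] (lam : ℂ) (p q : ℕ →₀ V) :
    cev lam (p + q) = cev lam p + cev lam q :=
  Finsupp.sum_add_index' (fun _ => smul_zero _) (fun _ _ _ => smul_add _ _ _)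

theorem aux_csub_add {V : Type*} [AddCommGroup V] [Module ℂ[X] V] (lam : ℂ) (p q : ℕ →₀ V) :
    csub lam (p + q) = csub lam p + csub lam q :=
  Finsupp.sum_add_index' (fun _ => smul_zero _) (fun _ _ _ => smul_add _ _ _)

theorem aux_cev_neg {V : Type*} [AddCommGroup V] [Module ℂ V] (lam : ℂ) (p : ℕ →₀ V) :
    cev lam (-p) = - cev lam p := by
  have h := aux_cev_add lam (-p) p
  rw [neg_add_cancel] at h
  have h0 : cev lam (0 : ℕ →₀ V) = 0 := Finsupp.sum_zero_index
  rw [h0] at h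
  exact eq_neg_of_add_eq_zero_left h.symm

theorem aux_cev_ext {V : Type*} [AddCommGroup V] [Module ℂ V] (p q : ℕ →₀ V)
    (h : ∀ lam : ℂ, cev lam p = cev lam q) : p = q := by
  rw [← sub_eq_zero]
  apply aux_cev_inj
  intro lam
  rw [sub_eq_add_neg, aux_cev_add, aux_cev_neg, h, add_neg_cancel]

theorem aux_cev_map {V W : Type*} [AddCommGroup V] [Module ℂ V] [Module ℂ[X] V]
    [IsScalarTower ℂ ℂ[X] V] [AddCommGroup W] [Module ℂ W] [Module ℂ[X] W]
    [IsScalarTower ℂ ℂ[X] W] (T : V →ₗ[ℂ[X]] W) (lam : ℂ) (p : ℕ →₀ V) :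
    cev lam (p.mapRange T (map_zero T)) = T (cev lam p) := by
  unfold cev
  rw [Finsupp.sum_mapRange_index (fun _ => smul_zero _), Finsupp.sum, Finsupp.sum, map_sum]
  exact Finset.sum_congr rfl fun i _ => (LinearMap.map_smul_of_tower T _ _).symm

theorem aux_csub_map {V W : Type*} [AddCommGroup V] [Module ℂ[X] V]
    [AddCommGroup W] [Module ℂ[X] W]
    (T : V →ₗ[ℂ[X]] W) (lam : ℂ) (p : ℕ →₀ V) :
    csub lam (p.mapRange T (map_zero T)) = T (csub lam p) := by
  unfold csub
  rw [Finsupp.sum_mapRange_index (fun _ => smul_zero _), Finsupp.sum, Finsupp.sum, map_sum]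
  exact Finset.sum_congr rfl fun i _ => (map_smul T _ _).symm

/-- if `φ` is a commutative 2-cocycle (`φ_λ(a,b) = φ_{-λ-∂}(b,a)`)
and `T` a `φ`-Rota-Baxter operator, then `T` is an `𝒪`-operator on the
commutator Lie conformal algebra `A^L` with respect to the representation
`ρ(a)_λ m = a_λ m - m_{-λ-∂} a`. -/
theorem stmt12 {A M : Type*}
    [AddCommGroup A] [Module ℂ A] [Module ℂ[X] A] [IsScalarTower ℂ ℂ[X] A]
    [AddCommGroup M] [Module ℂ M] [Module ℂ[X] M] [IsScalarTower ℂ ℂ[X] M]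
    (θ : AssocConfAlg A) (ρ : ConfBimod θ M) (φ : ConfBilin A A M)
    (hφ : IsTwoCocycle ρ φ)
    (hcomm : ∀ (lam : ℂ) (a b : A), φ.mul lam a b = φ.mulNeg lam b a)
    (T : M →ₗ[ℂ[X]] A) (hT : IsTwistedRB ρ φ ⇑T) :
    ∀ (lam : ℂ) (m n : M),
      θ.mul lam (T m) (T n) - θ.mulNeg lam (T n) (T m) =
        T ((ρ.l.mul lam (T m) n - ρ.r.mulNeg lam n (T m))
            - (ρ.l.mulNeg lam (T n) m - ρ.r.mul lam m (T n))) := by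
  intro lam m n
  have hc : θ.coeff (T n) (T m) =
      (ρ.l.coeff (T n) m + ρ.r.coeff n (T m) + φ.coeff (T n) (T m)).mapRange T (map_zero T) := by
    apply aux_cev_ext
    intro x
    rw [aux_cev_map, aux_cev_add, aux_cev_add]
    exact hT x n m
  have h1 : θ.mulNeg lam (T n) (T m) =
      T (ρ.l.mulNeg lam (T n) m + ρ.r.mulNeg lam n (T m) + φ.mulNeg lam (T n) (T m)) := by
    change csub lam (θ.coeff (T n) (T m)) = _
    rw [hc, aux_csub_map, aux_csub_add, aux_csub_add]
    rfl
  rw [h1, hT lam m n, hcomm lam (T m) (T n), ← map_sub]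
  congr 1
  abel
end
end
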